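/- Let v = 01100101 and w = 01010110. Then there exists a bijection φ: Ω_{v,w}(v) → Ω_{v,w}(w) such that ℙ_p(x) = ℙ_p(φ(x)) for every x ∈ Ω_{v,w}(v) and every p ∈ (0,1). Consequently Win(v,w;p) = 1/2 for all p ∈ (0,1). Moreover, the pair (v,w) does not have property R. -/

import Mathlib

open scoped BigOperators

/-- Bernoulli(p) weight of a binary word `u`: `ℙ_p(u) = p^{‖u‖₁} (1-p)^{‖u‖₀}`. -/
noncomputable def wProb (p : ℝ) (u : List Bool) : ℝ :=
  p ^ (u.count true) * (1 - p) ^ (u.count false)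

/-- Number of occurrences of `v` as a contiguous subword of `u`. -/
def occCount (v u : List Bool) : ℕ :=
  (List.range (u.length + 1)).countP (fun i => decide (v <+: u.drop i))

/-- `Ω_{v,w}(v)`: binary words having `v` as a suffix, containing `v` exactly once
as a subword, and not containing `w` as a subword.  (`Ω_{v,w}(w) = OmegaWin w v`.) -/
def OmegaWin (v w : List Bool) : Set (List Bool) :=
  {u | v <:+ u ∧ occCount v u = 1 ∧ ¬ (w <:+: u)}

/-- The win probability `Win(v,w;p) = ∑_{u ∈ Ω_{v,w}(v)} ℙ_p(u)`. -/
noncomputable def Win (v w : List Bool) (p : ℝ) : ℝ :=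
  ∑' u : OmegaWin v w, wProb p u

/-- The correlation polynomial `vw_p = ∑_{u ∈ O(v,w)} ℙ_p(u)⁻¹`, where `O(v,w)` is
the set of nonempty words that are simultaneously a suffix of `v` and a prefix of `w`. -/
noncomputable def corr (v w : List Bool) (p : ℝ) : ℝ :=
  ∑ i ∈ Finset.Icc 1 w.length,
    if w.take i <:+ v then (wProb p (w.take i))⁻¹ else 0

/-- `Ω*_{v,w}(v) = {x : x ++ v ∈ Ω_{v,w}(v)}` (with `x` possibly empty). -/
def OmegaStarV (v w : List Bool) : Set (List Bool) :=
  {x | x ++ v ∈ OmegaWin v w}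

/-- Property `R`: `Ω*_{v,w}(v) = Ω*_{v,w}(w)`. -/
def PropR (v w : List Bool) : Prop :=
  OmegaStarV v w = {x | x ++ w ∈ OmegaWin w v}

/-- `D(v,w)`: nonempty proper prefixes `v₁⋯v_{n-k}` of `v` (`1 ≤ k ≤ n-1`) such that
`w₁⋯w_k = v_{n-k+1}⋯v_n`. -/
def Dset (v w : List Bool) : Set (List Bool) :=
  {x | ∃ k, 1 ≤ k ∧ k ≤ v.length - 1 ∧ k ≤ w.length ∧
    x = v.take (v.length - k) ∧ w.take k = v.drop (v.length - k)}

/-- `F(v,w) = D(v,v) ∪ D(w,w) ∪ D(w,v) ∪ D(v,w)`. -/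
def Fset (v w : List Bool) : Set (List Bool) :=
  Dset v v ∪ Dset w w ∪ Dset w v ∪ Dset v w

/-- `a^m`: concatenation of `m` copies of the word `a`. -/
def wpow (a : List Bool) (m : ℕ) : List Bool :=
  (List.replicate m a).flatten

theorem occCount_cons (v u : List Bool) (x : Bool) :
    occCount v (x :: u) = (if v <+: x :: u then 1 else 0) + occCount v u := by
  unfold occCount
  rw [List.length_cons, List.range_succ_eq_map, List.countP_cons, List.countP_map, add_comm]
  simp [Function.comp_def]

theorem occCount_nil {v : List Bool} (hv : v ≠ []) : occCount v [] = 0 := by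
  simp [occCount, hv]

theorem occCount_eq_zero_iff {v : List Bool} (hv : v ≠ []) (u : List Bool) :
    occCount v u = 0 ↔ ¬ v <:+: u := by
  induction u with
  | nil => simp [occCount_nil hv, hv]
  | cons x u ih =>
    rw [occCount_cons, List.infix_cons_iff]
    by_cases h : v <+: x :: u <;> simp [h, ih]

theorem occCount_concat {v : List Bool} (hv : v ≠ []) (u : List Bool) (x : Bool) :
    occCount v (u ++ [x]) = occCount v u + (if v <:+ u ++ [x] then 1 else 0) := by
  induction u with
  | nil =>
    have h : v <+: [x] ↔ v <:+ [x] := by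
      rw [List.prefix_cons_iff, List.suffix_cons_iff]
      simp [hv]
    simp [occCount_cons, occCount_nil hv, h]
  | cons y u ih =>
    rw [List.cons_append, occCount_cons, ih, occCount_cons]
    have hp : v <+: y :: (u ++ [x]) ↔ v = y :: (u ++ [x]) ∨ v <+: y :: u := by
      simpa using List.prefix_concat_iff (l₁ := v) (l₂ := y :: u) (a := x)
    have hs : v <:+ y :: (u ++ [x]) ↔ v = y :: (u ++ [x]) ∨ v <:+ u ++ [x] :=
      List.suffix_cons_iff
    by_cases h : v = y :: (u ++ [x])
    · have h1 : ¬ v <+: y :: u := fun h' => by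
        have := h'.length_le
        simp [h] at this
      have h2 : ¬ v <:+ u ++ [x] := fun h' => by
        have := h'.length_le
        simp [h] at this
      rw [if_pos (hp.2 (.inl h)), if_pos (hs.2 (.inl h)), if_neg h1, if_neg h2]
      omega
    · simp only [hp, hs, h, false_or]
      omega

/-- Neither `v` nor `w` occurs as a block of `u`. -/
def Avoids (v w u : List Bool) : Prop := ¬ v <:+: u ∧ ¬ w <:+: u

theorem avoids_comm {v w u : List Bool} : Avoids v w u ↔ Avoids w v u := and_comm

theorem Avoids.of_isInfix {v w s u : List Bool} (h : Avoids v w u) (hs : s <:+: u) :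
    Avoids v w s :=
  ⟨fun h' => h.1 (h'.trans hs), fun h' => h.2 (h'.trans hs)⟩

section SameLength

variable {v w : List Bool}

theorem ne_nil_of_length_eq_of_ne (hlen : v.length = w.length) (hne : v ≠ w) : v ≠ [] := by
  rintro rfl
  exact hne (List.length_eq_zero_iff.1 hlen.symm).symm

theorem not_suffix_of_suffix (hlen : v.length = w.length) (hne : v ≠ w) {u : List Bool}
    (h : v <:+ u) : ¬ w <:+ u := fun h' =>
  hne ((List.suffix_of_suffix_length_le h h' hlen.le).eq_of_length hlen)

theorem concat_mem_OmegaWin_iff (hlen : v.length = w.length) (hne : v ≠ w)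
    {u : List Bool} {x : Bool} :
    u ++ [x] ∈ OmegaWin v w ↔ v <:+ u ++ [x] ∧ Avoids v w u := by
  have hv := ne_nil_of_length_eq_of_ne hlen hne
  simp only [OmegaWin, Set.mem_ofPred_eq, Avoids]
  refine and_congr_right fun h => ?_
  rw [occCount_concat hv, if_pos h, List.infix_concat_iff, ← occCount_eq_zero_iff hv]
  simp [not_suffix_of_suffix hlen hne h]

theorem nil_notMem_OmegaWin (hlen : v.length = w.length) (hne : v ≠ w) :
    [] ∉ OmegaWin v w := fun h =>
  ne_nil_of_length_eq_of_ne hlen hne (List.suffix_nil.1 h.1)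

theorem disjoint_OmegaWin (hlen : v.length = w.length) (hne : v ≠ w) :
    Disjoint (OmegaWin v w) (OmegaWin w v) :=
  Set.disjoint_left.2 fun _ h h' => not_suffix_of_suffix hlen hne h.1 h'.1

theorem concat_mem_union_iff (hlen : v.length = w.length) (hne : v ≠ w)
    {u : List Bool} {x : Bool} :
    u ++ [x] ∈ OmegaWin v w ∪ OmegaWin w v ↔ Avoids v w u ∧ ¬ Avoids v w (u ++ [x]) := by
  rw [Set.mem_union, concat_mem_OmegaWin_iff hlen hne,
    concat_mem_OmegaWin_iff hlen.symm hne.symm, avoids_comm (v := w)]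
  simp only [Avoids, List.infix_concat_iff]
  tauto

theorem avoids_of_append_mem_union (hlen : v.length = w.length) (hne : v ≠ w)
    {s t : List Bool} (ht : t ≠ []) (h : s ++ t ∈ OmegaWin v w ∪ OmegaWin w v) :
    Avoids v w s := by
  obtain ⟨t', x, rfl⟩ := List.eq_nil_or_concat' t |>.resolve_left ht
  rw [← List.append_assoc, concat_mem_union_iff hlen hne] at h
  exact h.1.of_isInfix (List.prefix_append _ _).isInfix

theorem not_avoids_of_mem_union {u : List Bool} (h : u ∈ OmegaWin v w ∪ OmegaWin w v) :
    ¬ Avoids v w u := by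
  rintro ⟨h1, h2⟩
  rcases h with h | h
  exacts [h1 h.1.isInfix, h2 h.1.isInfix]

/-- A word leaving the avoiding set while being extended by `z` hits `v` or `w` for a first
time. -/
theorem exists_take_mem_union (hlen : v.length = w.length) (hne : v ≠ w)
    {s z : List Bool} (hs : Avoids v w s) (hz : ¬ Avoids v w (s ++ z)) :
    ∃ k, 1 ≤ k ∧ k ≤ z.length ∧ s ++ z.take k ∈ OmegaWin v w ∪ OmegaWin w v := by
  induction z generalizing s with
  | nil => simp [hs] at hz
  | cons x z ih =>
    by_cases h : Avoids v w (s ++ [x])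
    · obtain ⟨k, hk, hk', hm⟩ := ih h (by simpa using hz)
      exact ⟨k + 1, by omega, by simpa using hk', by simpa using hm⟩
    · exact ⟨1, le_rfl, by simp, by simpa using (concat_mem_union_iff hlen hne).2 ⟨hs, h⟩⟩

theorem take_mem_union_unique (hlen : v.length = w.length) (hne : v ≠ w)
    {s z : List Bool} {j k : ℕ} (hj : j ≤ z.length) (hk : k ≤ z.length)
    (hmj : s ++ z.take j ∈ OmegaWin v w ∪ OmegaWin w v)
    (hmk : s ++ z.take k ∈ OmegaWin v w ∪ OmegaWin w v) : j = k := by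
  wlog hjk : j < k generalizing j k
  · rcases Nat.lt_trichotomy j k with h | h | h
    · exact absurd h hjk
    · exact h
    · exact (this hk hj hmk hmj h).symm
  have e : s ++ z.take k = (s ++ z.take j) ++ (z.take k).drop j := by
    have h1 : z.take j = (z.take k).take j := by rw [List.take_take, min_eq_left hjk.le]
    rw [List.append_assoc, h1, List.take_append_drop]
  rw [e] at hmk
  refine absurd (avoids_of_append_mem_union hlen hne ?_ hmk) (not_avoids_of_mem_union hmj)
  intro h0
  have := congrArg List.length h0
  simp at this
  omega

theorem suffix_of_append_mem_OmegaWin {s t : List Bool} (ht : t.length ≤ v.length)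
    (h : s ++ t ∈ OmegaWin v w) : t <:+ v :=
  List.suffix_of_suffix_length_le (List.suffix_append s t) h.1 ht

/-- The elements of a set of words with prescribed numbers of ones and zeros. -/
def withCounts (X : Set (List Bool)) (c d : ℕ) : Set (List Bool) :=
  {u | u ∈ X ∧ u.count true = c ∧ u.count false = d}

theorem withCounts_finite (X : Set (List Bool)) (c d : ℕ) : (withCounts X c d).Finite := by
  refine (List.finite_length_eq Bool (c + d)).subset ?_
  rintro u ⟨-, rfl, rfl⟩
  exact (List.count_true_add_count_false u).symm

theorem ncard_append_mem_OmegaWin (hlen : v.length = w.length) (hne : v ≠ w)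
    {t : List Bool} (ht : t ≠ []) (htv : t <:+ v) (c d : ℕ) :
    (withCounts {s | Avoids v w s ∧ s ++ t ∈ OmegaWin v w} c d).ncard =
      (withCounts (OmegaWin v w) (c + t.count true) (d + t.count false)).ncard := by
  rw [← Set.ncard_image_of_injective _ (List.append_left_injective t)]
  congr 1
  ext u
  simp only [withCounts, Set.mem_image, Set.mem_ofPred_eq]
  constructor
  · rintro ⟨s, ⟨⟨-, h⟩, rfl, rfl⟩, rfl⟩
    exact ⟨h, by simp, by simp⟩
  · rintro ⟨h, h1, h2⟩
    obtain ⟨s, rfl⟩ := htv.trans h.1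
    rw [List.count_append] at h1 h2
    exact ⟨s, ⟨⟨avoids_of_append_mem_union hlen hne ht (.inl h), h⟩, by omega, by omega⟩, rfl⟩

theorem ncard_append_mem_OmegaWin_of_length_le (hlen : v.length = w.length) (hne : v ≠ w)
    {t : List Bool} (ht : t ≠ []) (htl : t.length ≤ v.length) (c d : ℕ) :
    (withCounts {s | Avoids v w s ∧ s ++ t ∈ OmegaWin v w} c d).ncard =
      if t <:+ v then
        (withCounts (OmegaWin v w) (c + t.count true) (d + t.count false)).ncard else 0 := by
  split_ifs with h
  · exact ncard_append_mem_OmegaWin hlen hne ht h c d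
  · rw [Set.ncard_eq_zero (withCounts_finite _ _ _), Set.eq_empty_iff_forall_notMem]
    rintro s ⟨⟨-, hs⟩, -⟩
    exact h (suffix_of_append_mem_OmegaWin htl hs)

/-- Splitting avoiding words `s` according to where `s ++ z` first meets `v` or `w`. -/
theorem ncard_avoids_eq_sum (hlen : v.length = w.length) (hne : v ≠ w)
    {z : List Bool} (hz : z = v ∨ z = w) (c d : ℕ) :
    (withCounts {s | Avoids v w s} c d).ncard =
      ∑ k ∈ Finset.Icc 1 z.length,
        ((if z.take k <:+ v then (withCounts (OmegaWin v w)
            (c + (z.take k).count true) (d + (z.take k).count false)).ncard else 0) +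
          (if z.take k <:+ w then (withCounts (OmegaWin w v)
            (c + (z.take k).count true) (d + (z.take k).count false)).ncard else 0)) := by
  have hzl : z.length = v.length := by rcases hz with rfl | rfl <;> simp [hlen]
  have hsplit : withCounts {s | Avoids v w s} c d =
      ⋃ k ∈ (Finset.Icc 1 z.length : Set ℕ), withCounts
        {s | Avoids v w s ∧ s ++ z.take k ∈ OmegaWin v w ∪ OmegaWin w v} c d := by
    ext s
    simp only [withCounts, Set.mem_iUnion, Set.mem_ofPred_eq, Finset.coe_Icc, Set.mem_Icc]
    constructor
    · rintro ⟨hs, h⟩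
      have hsz : ¬ Avoids v w (s ++ z) := by
        rintro ⟨h1, h2⟩
        rcases hz with rfl | rfl
        exacts [h1 (List.suffix_append _ _).isInfix, h2 (List.suffix_append _ _).isInfix]
      obtain ⟨k, hk, hk', hm⟩ := exists_take_mem_union hlen hne hs hsz
      exact ⟨k, ⟨hk, hk'⟩, ⟨hs, hm⟩, h⟩
    · rintro ⟨k, -, ⟨hs, -⟩, h⟩
      exact ⟨hs, h⟩
  have hdisj : (Finset.Icc 1 z.length : Set ℕ).PairwiseDisjoint fun k => withCounts
      {s | Avoids v w s ∧ s ++ z.take k ∈ OmegaWin v w ∪ OmegaWin w v} c d := by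
    intro j hj k hk hjk
    refine Set.disjoint_left.2 ?_
    rintro s ⟨⟨-, h1⟩, -⟩ ⟨⟨-, h2⟩, -⟩
    simp only [Finset.coe_Icc, Set.mem_Icc] at hj hk
    exact hjk (take_mem_union_unique hlen hne hj.2 hk.2 h1 h2)
  rw [hsplit, Set.Finite.ncard_biUnion (Finset.finite_toSet _)
    (fun k _ => withCounts_finite _ _ _) hdisj, finsum_mem_coe_finset]
  refine Finset.sum_congr rfl fun k hk => ?_
  rw [Finset.mem_Icc] at hk
  have ht : z.take k ≠ [] := by
    intro h0
    have := congrArg List.length h0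
    simp only [List.length_take, List.length_nil] at this
    omega
  have htl : (z.take k).length ≤ v.length := by simp [hzl]
  rw [← ncard_append_mem_OmegaWin_of_length_le hlen hne ht htl,
    ← ncard_append_mem_OmegaWin_of_length_le hlen.symm hne.symm ht (hlen ▸ htl),
    ← Set.ncard_union_eq _ (withCounts_finite _ _ _) (withCounts_finite _ _ _)]
  · congr 1
    ext s
    simp only [withCounts, Set.mem_union, Set.mem_ofPred_eq, avoids_comm (v := w)]
    tauto
  · refine Set.disjoint_left.2 ?_
    rintro s ⟨⟨-, h1⟩, -⟩ ⟨⟨-, h2⟩, -⟩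
    exact Set.disjoint_left.1 (disjoint_OmegaWin hlen hne) h1 h2

theorem withCounts_OmegaWin_eq_empty {c d : ℕ}
    (h : c < v.count true ∨ d < v.count false) : withCounts (OmegaWin v w) c d = ∅ := by
  rw [Set.eq_empty_iff_forall_notMem]
  rintro u ⟨hu, rfl, rfl⟩
  have h1 := hu.1.sublist.count_le true
  have h2 := hu.1.sublist.count_le false
  omega

theorem exists_bijective_of_ncard_withCounts_eq {X Y : Set (List Bool)}
    (h : ∀ c d, (withCounts X c d).ncard = (withCounts Y c d).ncard) :
    ∃ φ : X → Y, Function.Bijective φ ∧ ∀ x : X,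
      (φ x : List Bool).count true = (x : List Bool).count true ∧
      (φ x : List Bool).count false = (x : List Bool).count false := by
  let cnt : ∀ Z : Set (List Bool), Z → ℕ × ℕ := fun Z u =>
    ((u : List Bool).count true, (u : List Bool).count false)
  have e (Z : Set (List Bool)) (i : ℕ × ℕ) : {a // cnt Z a = i} ≃ withCounts Z i.1 i.2 :=
    { toFun := fun a => ⟨a.1, a.1.2, congrArg Prod.fst a.2, congrArg Prod.snd a.2⟩
      invFun := fun a => ⟨⟨a, a.2.1⟩, Prod.ext a.2.2.1 a.2.2.2⟩
      left_inv := fun _ => rfl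
      right_inv := fun _ => rfl }
  have hfib (i : ℕ × ℕ) : Nonempty ({a // cnt X a = i} ≃ {b // cnt Y b = i}) := by
    have := (withCounts_finite X i.1 i.2).to_subtype
    have := (withCounts_finite Y i.1 i.2).to_subtype
    obtain ⟨g⟩ := Finite.card_eq.1 (h i.1 i.2)
    exact ⟨(e X i).trans (g.trans (e Y i).symm)⟩
  let f := fun i => (hfib i).some
  refine ⟨Equiv.ofFiberEquiv f, Equiv.bijective _, fun x => ?_⟩
  have := Equiv.ofFiberEquiv_map f x
  exact ⟨congrArg Prod.fst this, congrArg Prod.snd this⟩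

end SameLength

theorem ncard_withCounts_OmegaWin_eq (c d : ℕ) :
    (withCounts (OmegaWin [false, true, true, false, false, true, false, true]
      [false, true, false, true, false, true, true, false]) c d).ncard =
    (withCounts (OmegaWin [false, true, false, true, false, true, true, false]
      [false, true, true, false, false, true, false, true]) c d).ncard := by
  set v := [false, true, true, false, false, true, false, true] with hv
  set w := [false, true, false, true, false, true, true, false] with hw
  induction c using Nat.strong_induction_on generalizing d with
  | _ c ih =>
    by_cases h : c < 4 ∨ d < 4
    · rw [withCounts_OmegaWin_eq_empty (by exact h), withCounts_OmegaWin_eq_empty (by exact h)]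
    · obtain ⟨c, rfl⟩ := Nat.exists_eq_add_of_le' (show 4 ≤ c by omega)
      obtain ⟨d, rfl⟩ := Nat.exists_eq_add_of_le' (show 4 ≤ d by omega)
      have hlen : v.length = w.length := rfl
      have hne : v ≠ w := by decide
      have h1 := ncard_avoids_eq_sum hlen hne (.inl rfl) c d
      have h2 := ncard_avoids_eq_sum hlen hne (.inr rfl) c d
      have hI := ih (c + 2) (by omega) (d + 2)
      have hIcc : Finset.Icc 1 8 = {1, 2, 3, 4, 5, 6, 7, 8} := by decide
      have lv : v.length = 8 := rfl
      have lw : w.length = 8 := rfl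
      rw [lv, hIcc] at h1
      rw [lw, hIcc] at h2
      generalize (withCounts {s | Avoids v w s} c d).ncard = N at h1 h2
      have key : ∀ (a b : ℕ → ℕ → ℕ),
        N = ∑ k ∈ ({1, 2, 3, 4, 5, 6, 7, 8} : Finset ℕ),
          ((if v.take k <:+ v then a (c + (v.take k).count true) (d + (v.take k).count false)
            else 0) +
          (if v.take k <:+ w then b (c + (v.take k).count true) (d + (v.take k).count false)
            else 0)) →
        N = ∑ k ∈ ({1, 2, 3, 4, 5, 6, 7, 8} : Finset ℕ),
          ((if w.take k <:+ v then a (c + (w.take k).count true) (d + (w.take k).count false)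
            else 0) +
          (if w.take k <:+ w then b (c + (w.take k).count true) (d + (w.take k).count false)
            else 0)) →
        a (c + 2) (d + 2) = b (c + 2) (d + 2) → a (c + 4) (d + 4) = b (c + 4) (d + 4) := by
        intro a b h1 h2 h3
        simp [hv, hw, List.suffix_cons_iff] at h1 h2
        omega
      exact key (fun c d => (withCounts (OmegaWin v w) c d).ncard)
        (fun c d => (withCounts (OmegaWin w v) c d).ncard) h1 h2 hI

/-- The binary words of length `n`. -/
def words : ℕ → Finset (List Bool)
  | 0 => {[]}
  | n + 1 => (words n).image (· ++ [true]) ∪ (words n).image (· ++ [false])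

theorem mem_words {n : ℕ} {u : List Bool} : u ∈ words n ↔ u.length = n := by
  induction n generalizing u with
  | zero => simp [words]
  | succ n ih =>
    simp only [words, Finset.mem_union, Finset.mem_image, ih]
    constructor
    · rintro (⟨s, rfl, rfl⟩ | ⟨s, rfl, rfl⟩) <;> simp
    · intro h
      obtain ⟨s, x, rfl⟩ := (List.eq_nil_or_concat' u).resolve_left (by rintro rfl; simp at h)
      cases x <;> simp_all

theorem sum_words_succ (f : List Bool → ℝ) (n : ℕ) :
    ∑ u ∈ words (n + 1), f u = ∑ u ∈ words n, (f (u ++ [true]) + f (u ++ [false])) := by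
  rw [words, Finset.sum_union, Finset.sum_image, Finset.sum_image, Finset.sum_add_distrib]
  · exact (List.append_left_injective _).injOn
  · exact (List.append_left_injective _).injOn
  · refine Finset.disjoint_left.2 fun u h1 h2 => ?_
    obtain ⟨s, -, rfl⟩ := Finset.mem_image.1 h1
    obtain ⟨t, -, h⟩ := Finset.mem_image.1 h2
    simp at h

theorem wProb_append (p : ℝ) (s t : List Bool) : wProb p (s ++ t) = wProb p s * wProb p t := by
  simp only [wProb, List.count_append, pow_add]
  ring

theorem wProb_nonneg {p : ℝ} (hp : p ∈ Set.Ioo (0 : ℝ) 1) (u : List Bool) : 0 ≤ wProb p u :=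
  mul_nonneg (pow_nonneg hp.1.le _) (pow_nonneg (sub_nonneg.2 hp.2.le) _)

theorem wProb_pos {p : ℝ} (hp : p ∈ Set.Ioo (0 : ℝ) 1) (u : List Bool) : 0 < wProb p u :=
  mul_pos (pow_pos hp.1 _) (pow_pos (sub_pos.2 hp.2) _)

theorem wProb_le_one {p : ℝ} (hp : p ∈ Set.Ioo (0 : ℝ) 1) (u : List Bool) : wProb p u ≤ 1 :=
  mul_le_one₀ (pow_le_one₀ hp.1.le hp.2.le) (pow_nonneg (sub_nonneg.2 hp.2.le) _)
    (pow_le_one₀ (sub_nonneg.2 hp.2.le) (by linarith [hp.1]))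

/-- The probability that a random word of length `n` lies in `X`. -/
noncomputable def lengthProb (p : ℝ) (X : Set (List Bool)) (n : ℕ) : ℝ :=
  ∑ u ∈ words n, X.indicator (wProb p) u

theorem lengthProb_nonneg {p : ℝ} (hp : p ∈ Set.Ioo (0 : ℝ) 1) (X : Set (List Bool)) (n : ℕ) :
    0 ≤ lengthProb p X n :=
  Finset.sum_nonneg fun u _ => Set.indicator_nonneg (fun _ _ => wProb_nonneg hp _) u

section FirstHit

variable {v w : List Bool} {p : ℝ}

theorem lengthProb_avoids_eq_add (hlen : v.length = w.length) (hne : v ≠ w) (n : ℕ) :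
    lengthProb p {u | Avoids v w u} n = lengthProb p {u | Avoids v w u} (n + 1) +
      lengthProb p (OmegaWin v w ∪ OmegaWin w v) (n + 1) := by
  classical
  simp only [lengthProb]
  rw [← Finset.sum_add_distrib, sum_words_succ]
  refine Finset.sum_congr rfl fun u _ => ?_
  have step (x : Bool) : Set.indicator {u | Avoids v w u} (wProb p) (u ++ [x]) +
      Set.indicator (OmegaWin v w ∪ OmegaWin w v) (wProb p) (u ++ [x]) =
      Set.indicator {u | Avoids v w u} (wProb p) u * wProb p [x] := by
    simp only [Set.indicator_apply, concat_mem_union_iff hlen hne, Set.mem_ofPred_eq,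
      wProb_append]
    by_cases h : Avoids v w u
    · by_cases h' : Avoids v w (u ++ [x]) <;> simp [h, h']
    · have h' : ¬ Avoids v w (u ++ [x]) := fun h' =>
        h (h'.of_isInfix (List.prefix_append _ _).isInfix)
      simp [h, h']
  rw [step, step, ← mul_add]
  simp [wProb]

theorem sum_lengthProb_union (hlen : v.length = w.length) (hne : v ≠ w) (n : ℕ) :
    ∑ k ∈ Finset.range n, lengthProb p (OmegaWin v w ∪ OmegaWin w v) (k + 1) =
      1 - lengthProb p {u | Avoids v w u} n := by
  induction n with
  | zero =>
    have hv := ne_nil_of_length_eq_of_ne hlen hne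
    have hw := ne_nil_of_length_eq_of_ne hlen.symm hne.symm
    simp [lengthProb, words, Avoids, hv, hw, wProb, Set.indicator_apply]
  | succ n ih =>
    rw [Finset.sum_range_succ, ih, lengthProb_avoids_eq_add hlen hne n]
    ring

theorem antitone_lengthProb_avoids (hlen : v.length = w.length) (hne : v ≠ w)
    (hp : p ∈ Set.Ioo (0 : ℝ) 1) : Antitone (lengthProb p {u | Avoids v w u}) :=
  antitone_nat_of_succ_le fun n => by
    rw [lengthProb_avoids_eq_add hlen hne n]
    exact le_add_of_nonneg_right (lengthProb_nonneg hp _ _)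

theorem lengthProb_append_le (hp : p ∈ Set.Ioo (0 : ℝ) 1) (X : Set (List Bool))
    (t : List Bool) (n : ℕ) :
    ∑ s ∈ words n, X.indicator (wProb p) (s ++ t) ≤ lengthProb p X (n + t.length) := by
  rw [lengthProb, ← Finset.sum_image (f := X.indicator (wProb p))
    (List.append_left_injective t).injOn]
  refine Finset.sum_le_sum_of_subset_of_nonneg ?_
    fun u _ _ => Set.indicator_nonneg (fun _ _ => wProb_nonneg hp _) u
  intro u hu
  obtain ⟨s, hs, rfl⟩ := Finset.mem_image.1 hu
  simp [mem_words, mem_words.1 hs]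

theorem lengthProb_avoids_mul_le (hlen : v.length = w.length) (hne : v ≠ w)
    (hp : p ∈ Set.Ioo (0 : ℝ) 1) (n : ℕ) :
    lengthProb p {u | Avoids v w u} n * wProb p v ≤
      lengthProb p {u | Avoids v w u} n - lengthProb p {u | Avoids v w u} (n + v.length) := by
  set H := OmegaWin v w ∪ OmegaWin w v
  have htel : lengthProb p {u | Avoids v w u} n -
      lengthProb p {u | Avoids v w u} (n + v.length) =
      ∑ k ∈ Finset.range v.length, lengthProb p H (n + (k + 1)) := by
    have h1 := sum_lengthProb_union (p := p) hlen hne n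
    have h2 := sum_lengthProb_union (p := p) hlen hne (n + v.length)
    rw [Finset.sum_range_add, h1] at h2
    simp only [add_assoc] at h2
    linarith
  have hpt (s : List Bool) : Set.indicator {u | Avoids v w u} (wProb p) s * wProb p v ≤
      ∑ k ∈ Finset.range v.length, H.indicator (wProb p) (s ++ v.take (k + 1)) := by
    have hnn (k : ℕ) : 0 ≤ H.indicator (wProb p) (s ++ v.take (k + 1)) :=
      Set.indicator_nonneg (fun _ _ => wProb_nonneg hp _) _
    by_cases hs : Avoids v w s
    · have hsv : ¬ Avoids v w (s ++ v) := fun h => h.1 (List.suffix_append _ _).isInfix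
      obtain ⟨k, hk, hk', hm⟩ := exists_take_mem_union hlen hne hs hsv
      obtain ⟨k, rfl⟩ := Nat.exists_eq_add_of_le' hk
      refine le_trans ?_ (Finset.single_le_sum (fun k _ => hnn k)
        (Finset.mem_range.2 (Nat.lt_of_succ_le hk')))
      rw [Set.indicator_of_mem (by exact hs), Set.indicator_of_mem hm, wProb_append]
      refine mul_le_mul_of_nonneg_left ?_ (wProb_nonneg hp _)
      conv_lhs => rw [← List.take_append_drop (k + 1) v, wProb_append]
      exact mul_le_of_le_one_right (wProb_nonneg hp _) (wProb_le_one hp _)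
    · rw [Set.indicator_of_notMem (by exact hs), zero_mul]
      exact Finset.sum_nonneg fun k _ => hnn k
  rw [htel, lengthProb, Finset.sum_mul]
  refine (Finset.sum_le_sum fun s _ => hpt s).trans ?_
  rw [Finset.sum_comm]
  refine Finset.sum_le_sum fun k hk => ?_
  have := lengthProb_append_le hp H (v.take (k + 1)) n
  rwa [List.length_take, min_eq_left (Nat.succ_le_of_lt (Finset.mem_range.1 hk))] at this

theorem tendsto_lengthProb_avoids (hlen : v.length = w.length) (hne : v ≠ w)
    (hp : p ∈ Set.Ioo (0 : ℝ) 1) :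
    Filter.Tendsto (lengthProb p {u | Avoids v w u}) Filter.atTop (nhds 0) := by
  have hbdd : BddBelow (Set.range (lengthProb p {u | Avoids v w u})) :=
    ⟨0, by rintro _ ⟨n, rfl⟩; exact lengthProb_nonneg hp _ _⟩
  have hlim := tendsto_atTop_ciInf (antitone_lengthProb_avoids hlen hne hp) hbdd
  set L := ⨅ n, lengthProb p {u | Avoids v w u} n
  have hle : L * wProb p v ≤ L - L :=
    le_of_tendsto_of_tendsto' (hlim.mul_const _)
      (hlim.sub (hlim.comp (Filter.tendsto_add_atTop_nat v.length)))
      (lengthProb_avoids_mul_le hlen hne hp)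
  have h0 : 0 ≤ L := le_ciInf fun n => lengthProb_nonneg hp _ _
  have hL : L = 0 := by nlinarith [wProb_pos hp v]
  rwa [hL] at hlim

theorem hasSum_union (hlen : v.length = w.length) (hne : v ≠ w)
    (hp : p ∈ Set.Ioo (0 : ℝ) 1) :
    HasSum ((OmegaWin v w ∪ OmegaWin w v).indicator (wProb p)) 1 := by
  set H := OmegaWin v w ∪ OmegaWin w v
  have hnn : 0 ≤ H.indicator (wProb p) := Set.indicator_nonneg fun _ _ => wProb_nonneg hp _
  let B : ℕ → Finset (List Bool) := fun n => (Finset.range (n + 1)).biUnion words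
  have hmem {n : ℕ} {u : List Bool} : u ∈ B n ↔ u.length < n + 1 := by
    simp [B, mem_words]
  have hB (n : ℕ) : ∑ u ∈ B n, H.indicator (wProb p) u =
      1 - lengthProb p {u | Avoids v w u} n := by
    rw [Finset.sum_biUnion, ← sum_lengthProb_union hlen hne, Finset.sum_range_succ']
    · have h0 : [] ∉ H := by
        rintro (h | h)
        exacts [nil_notMem_OmegaWin hlen hne h, nil_notMem_OmegaWin hlen.symm hne.symm h]
      rw [show words 0 = {[]} from rfl, Finset.sum_singleton, Set.indicator_of_notMem h0, add_zero]
      rfl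
    · intro i _ j _ hij
      refine Finset.disjoint_left.2 fun u h1 h2 => hij ?_
      rw [← mem_words.1 h1, mem_words.1 h2]
  have hmono : Monotone B := fun m n hmn u hu => by
    rw [hmem] at hu ⊢
    omega
  have hsum : Summable (H.indicator (wProb p)) := by
    refine summable_of_sum_le hnn (c := 1) fun T => ?_
    have hT : T ⊆ B (T.sup List.length) := fun u hu =>
      hmem.2 (Nat.lt_succ_of_le (Finset.le_sup (f := List.length) hu))
    refine (Finset.sum_le_sum_of_subset_of_nonneg hT fun u _ _ => hnn u).trans ?_
    rw [hB]
    linarith [lengthProb_nonneg hp {u | Avoids v w u} (T.sup List.length)]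
  have hlim := hsum.hasSum.comp (Filter.tendsto_atTop_finset_of_monotone hmono
    fun u => ⟨u.length, hmem.2 (Nat.lt_succ_self _)⟩)
  have hlim' : Filter.Tendsto (fun n => 1 - lengthProb p {u | Avoids v w u} n)
      Filter.atTop (nhds (1 - 0)) := (tendsto_lengthProb_avoids hlen hne hp).const_sub 1
  have heq : ∑' u, H.indicator (wProb p) u = 1 := by
    rw [← sub_zero (1 : ℝ)]
    refine tendsto_nhds_unique hlim ?_
    simpa only [Function.comp_def, hB] using hlim'
  exact heq ▸ hsum.hasSum

theorem Win_add_Win (hlen : v.length = w.length) (hne : v ≠ w)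
    (hp : p ∈ Set.Ioo (0 : ℝ) 1) : Win v w p + Win w v p = 1 := by
  have h := hasSum_union hlen hne hp
  have hsum (X : Set (List Bool)) (hX : X ⊆ OmegaWin v w ∪ OmegaWin w v) :
      Summable (X.indicator (wProb p)) :=
    h.summable.of_nonneg_of_le
      (fun u => Set.indicator_nonneg (fun _ _ => wProb_nonneg hp _) u)
      (fun u => Set.indicator_le_indicator_of_subset hX (wProb_nonneg hp) u)
  rw [Win, Win, tsum_subtype (OmegaWin v w) (wProb p), tsum_subtype (OmegaWin w v) (wProb p),
    ← (hsum _ Set.subset_union_left).tsum_add (hsum _ Set.subset_union_right), ← h.tsum_eq,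
    Set.indicator_union_of_disjoint (disjoint_OmegaWin hlen hne)]

end FirstHit

/-- For `v = 01100101`, `w = 01010110`: a measure-preserving bijection
`Ω_{v,w}(v) → Ω_{v,w}(w)` exists, so `Win(v,w;p) = 1/2` for all `p`; yet the pair
does not have property `R`. -/
theorem stmt12 :
    (∃ φ : OmegaWin [false, true, true, false, false, true, false, true]
             [false, true, false, true, false, true, true, false] →
           OmegaWin [false, true, false, true, false, true, true, false]
             [false, true, true, false, false, true, false, true],
      Function.Bijective φ ∧
      ∀ x : OmegaWin [false, true, true, false, false, true, false, true]
             [false, true, false, true, false, true, true, false],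
        ∀ p ∈ Set.Ioo (0:ℝ) 1, wProb p (x : List Bool) = wProb p (φ x : List Bool)) ∧
    (∀ p ∈ Set.Ioo (0:ℝ) 1,
      Win [false, true, true, false, false, true, false, true]
        [false, true, false, true, false, true, true, false] p = 1/2) ∧
    ¬ PropR [false, true, true, false, false, true, false, true]
        [false, true, false, true, false, true, true, false] := by
  obtain ⟨φ, hφ, hcount⟩ := exists_bijective_of_ncard_withCounts_eq ncard_withCounts_OmegaWin_eq
  refine ⟨⟨φ, hφ, fun x p _ => ?_⟩, fun p hp => ?_, fun hR => ?_⟩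
  · rw [wProb, wProb, (hcount x).1, (hcount x).2]
  · have hsum := Win_add_Win (v := [false, true, true, false, false, true, false, true])
      (w := [false, true, false, true, false, true, true, false]) rfl (by decide) hp
    have heq : Win [false, true, true, false, false, true, false, true]
        [false, true, false, true, false, true, true, false] p =
        Win [false, true, false, true, false, true, true, false]
        [false, true, true, false, false, true, false, true] p := by
      rw [Win, Win, ← (Equiv.ofBijective φ hφ).tsum_eq]
      refine tsum_congr fun x => ?_
      rw [Equiv.ofBijective_apply, wProb, wProb, (hcount x).1, (hcount x).2]
    linarith
  · have hmem : [false, true, true, false] ∈ OmegaStarV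
        [false, true, true, false, false, true, false, true]
        [false, true, false, true, false, true, true, false] :=
      ⟨by decide, by decide, by decide⟩
    rw [hR] at hmem
    exact hmem.2.2 (by decide)
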